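/- arXiv:2408.09632 — 2 statements merged into one kernel-verified Lean document; each statement's English description precedes it below -/
import Mathlib

section
/- (MLP compression by Nyström approximation.) Let A_1, …, A_N be real T×d matrices, let C = Σ_{i=1}^N A_iᵀA_i be positive definite, let W_D be a real d×m matrix, and let S be a d×k column selection matrix such that SᵀCS is invertible. Define Ŵ_D = (SᵀCS)^{-1}SᵀCW_D. Then the Type-I reconstruction error satisfies Σ_{i=1}^N ‖A_i W_D − (A_i S)Ŵ_D‖_F² ≤ ‖W_D‖₂² · ‖C^{-1}‖₂ · ‖C − CS(SᵀCS)^{-1}SᵀC‖_F². -/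
open Matrix BigOperators

noncomputable section

/-- Squared Frobenius norm of a real matrix: `‖A‖_F² = ∑ᵢⱼ Aᵢⱼ²`. -/
def frobSq {m n : Type*} [Fintype m] [Fintype n] (A : Matrix m n ℝ) : ℝ :=
  ∑ i, ∑ j, (A i j) ^ 2

/-- Frobenius norm of a real matrix. -/
def frobNorm {m n : Type*} [Fintype m] [Fintype n] (A : Matrix m n ℝ) : ℝ :=
  Real.sqrt (frobSq A)

/-- Spectral norm (ℓ²→ℓ² operator norm, largest singular value) of a real matrix. -/
def specNorm {m n : Type*} [Fintype m] [Fintype n] [DecidableEq n] (A : Matrix m n ℝ) : ℝ :=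
  ‖LinearMap.toContinuousLinearMap (Matrix.toEuclideanLin A)‖

/-- `S` is a `k`-column selection matrix whose columns are the distinct standard basis
vectors indexed by the injective map `f`. -/
def IsColSel {d k : ℕ} (f : Fin k → Fin d) (S : Matrix (Fin d) (Fin k) ℝ) : Prop :=
  Function.Injective f ∧ ∀ i j, S i j = if i = f j then 1 else 0

open scoped Matrix.Norms.L2Operator in
theorem specNorm_transpose {m n : Type*} [Fintype m] [Fintype n] [DecidableEq m] [DecidableEq n]
    (A : Matrix m n ℝ) : specNorm Aᵀ = specNorm A := by
  have h := Matrix.l2_opNorm_conjTranspose A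
  rw [Matrix.conjTranspose_eq_transpose_of_trivial] at h
  exact h

theorem norm_toLp_mulVec_le {m n : Type*} [Fintype m] [Fintype n] [DecidableEq n]
    (A : Matrix m n ℝ) (x : n → ℝ) :
    ‖WithLp.toLp 2 (A *ᵥ x)‖ ≤ specNorm A * ‖WithLp.toLp 2 x‖ :=
  (LinearMap.toContinuousLinearMap (Matrix.toEuclideanLin A)).le_opNorm (WithLp.toLp 2 x)

theorem frobSq_transpose {m n : Type*} [Fintype m] [Fintype n] (A : Matrix m n ℝ) :
    frobSq Aᵀ = frobSq A :=
  Finset.sum_comm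

theorem frobSq_eq_sum_norm_sq_col {m n : Type*} [Fintype m] [Fintype n] (A : Matrix m n ℝ) :
    frobSq A = ∑ j, ‖WithLp.toLp 2 (A.col j)‖ ^ 2 := by
  rw [← frobSq_transpose]
  simp [frobSq, EuclideanSpace.norm_sq_eq]

theorem frobSq_eq_trace {m n : Type*} [Fintype m] [Fintype n] (A : Matrix m n ℝ) :
    frobSq A = (Aᵀ * A).trace := by
  rw [← frobSq_transpose]
  simp [frobSq, Matrix.trace, Matrix.mul_apply, sq]

theorem frobSq_mul_le_left {l m n : Type*} [Fintype l] [Fintype m] [Fintype n] [DecidableEq m]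
    (B : Matrix l m ℝ) (A : Matrix m n ℝ) :
    frobSq (B * A) ≤ specNorm B ^ 2 * frobSq A := by
  rw [frobSq_eq_sum_norm_sq_col, frobSq_eq_sum_norm_sq_col, Finset.mul_sum]
  refine Finset.sum_le_sum fun j _ => ?_
  rw [← mul_pow]
  exact pow_le_pow_left₀ (norm_nonneg _) (norm_toLp_mulVec_le B (A.col j)) 2

theorem frobSq_mul_le_right {l m n : Type*} [Fintype l] [Fintype m] [Fintype n] [DecidableEq m]
    [DecidableEq n] (A : Matrix l m ℝ) (B : Matrix m n ℝ) :
    frobSq (A * B) ≤ specNorm B ^ 2 * frobSq A := by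
  rw [← frobSq_transpose, Matrix.transpose_mul, ← specNorm_transpose, ← frobSq_transpose A]
  exact frobSq_mul_le_left _ _

theorem trace_transpose_mul_mul_le {m n : Type*} [Fintype m] [Fintype n] [DecidableEq m]
    (B : Matrix m m ℝ) (A : Matrix m n ℝ) :
    (Aᵀ * (B * A)).trace ≤ specNorm B * frobSq A := by
  rw [frobSq_eq_sum_norm_sq_col, Finset.mul_sum]
  refine Finset.sum_le_sum fun j _ => ?_
  have h : (Aᵀ * (B * A)).diag j =
      inner ℝ (WithLp.toLp 2 (B *ᵥ A.col j)) (WithLp.toLp 2 (A.col j)) := by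
    rw [EuclideanSpace.inner_toLp_toLp]
    rfl
  calc _ = _ := h
    _ ≤ ‖WithLp.toLp 2 (B *ᵥ A.col j)‖ * ‖WithLp.toLp 2 (A.col j)‖ := real_inner_le_norm _ _
    _ ≤ specNorm B * ‖WithLp.toLp 2 (A.col j)‖ * ‖WithLp.toLp 2 (A.col j)‖ := by
        gcongr
        exact norm_toLp_mulVec_le B _
    _ = _ := by ring

/-- **MLP compression by Nyström approximation** (Theorem 1). -/
theorem mlp_compression_nystrom
    {T d k m N : ℕ} (A : Fin N → Matrix (Fin T) (Fin d) ℝ)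
    (C : Matrix (Fin d) (Fin d) ℝ) (hC : C = ∑ i, (A i)ᵀ * A i) (hCpd : C.PosDef)
    (WD : Matrix (Fin d) (Fin m) ℝ)
    (f : Fin k → Fin d) (S : Matrix (Fin d) (Fin k) ℝ) (hS : IsColSel f S)
    (hinv : IsUnit (Sᵀ * C * S))
    (WDhat : Matrix (Fin k) (Fin m) ℝ)
    (hWDhat : WDhat = (Sᵀ * C * S)⁻¹ * (Sᵀ * C * WD)) :
    ∑ i, frobSq (A i * WD - (A i * S) * WDhat) ≤
      specNorm WD ^ 2 * specNorm C⁻¹ *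
        frobSq (C - C * S * (Sᵀ * C * S)⁻¹ * Sᵀ * C) := by
  set P : Matrix (Fin d) (Fin d) ℝ := 1 - S * (Sᵀ * C * S)⁻¹ * Sᵀ * C with hP
  have hres (i : Fin N) : A i * WD - A i * S * WDhat = A i * P * WD := by
    simp only [hWDhat, hP, Matrix.mul_sub, Matrix.sub_mul, Matrix.mul_one, Matrix.mul_assoc]
  have hE : C - C * S * (Sᵀ * C * S)⁻¹ * Sᵀ * C = C * P := by
    simp only [hP, Matrix.mul_sub, Matrix.mul_one, Matrix.mul_assoc]
  have hdet : IsUnit C.det := hCpd.det_pos.ne'.isUnit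
  have hCT : Cᵀ = C := by
    simp [hC, Matrix.transpose_sum]
  have hsum : ∑ i, frobSq (A i * P) = ((C * P)ᵀ * (C⁻¹ * (C * P))).trace := by
    rw [Matrix.nonsing_inv_mul_cancel_left _ _ hdet, Matrix.transpose_mul, hCT]
    simp only [frobSq_eq_trace, ← Matrix.trace_sum]
    simp only [hC, Matrix.transpose_mul, Matrix.mul_sum, Matrix.sum_mul, Matrix.mul_assoc]
  simp only [hres, hE]
  calc ∑ i, frobSq (A i * P * WD)
      ≤ ∑ i, specNorm WD ^ 2 * frobSq (A i * P) :=
        Finset.sum_le_sum fun i _ => frobSq_mul_le_right _ _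
    _ = specNorm WD ^ 2 * ((C * P)ᵀ * (C⁻¹ * (C * P))).trace := by
        rw [← Finset.mul_sum, hsum]
    _ ≤ specNorm WD ^ 2 * (specNorm C⁻¹ * frobSq (C * P)) := by
        gcongr
        exact trace_transpose_mul_mul_le _ _
    _ = _ := by ring

end
end

section
/- (Global sparsity allocation.) Let L ≥ 1, let s₁, …, s_L be real importance scores, and let 0 < φ_avg < 1. For ε > 0 define φ_i(ε) = L·φ_avg·exp(−s_i/ε) / Σ_{j=1}^L exp(−s_j/ε). Then there exists ε₀ > 0 such that for every ε > ε₀, the vector (φ_1(ε), …, φ_L(ε)) satisfies the constraints (1/L)Σ_{i=1}^L φ_i = φ_avg and 0 ≤ φ_i ≤ 1 for all i, and it maximizes the entropic-regularized objective Σ_{i=1}^L [ s_i(1−φ_i) + ε·H(φ_i) ], where H(φ) = −φ·log φ, over all vectors (φ_1, …, φ_L) satisfying these constraints. -/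
open BigOperators

noncomputable section

/-- The softmax sparsity allocation `φᵢ(ε) = L·φ_avg·exp(−sᵢ/ε)/∑ⱼexp(−sⱼ/ε)`. -/
def softAlloc (L : ℕ) (φavg : ℝ) (s : Fin L → ℝ) (ε : ℝ) (i : Fin L) : ℝ :=
  (L : ℝ) * φavg * Real.exp (-s i / ε) / ∑ j, Real.exp (-s j / ε)

/-- The entropic-regularized sparsity allocation objective
`∑ᵢ [sᵢ(1−φᵢ) + ε·H(φᵢ)]` with `H(φ) = −φ·log φ`. -/
def sparsityObj (L : ℕ) (s : Fin L → ℝ) (ε : ℝ) (φ : Fin L → ℝ) : ℝ :=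
  ∑ i, (s i * (1 - φ i) + ε * (-(φ i * Real.log (φ i))))

open Filter Topology in
/-- In the high-temperature limit the softmax allocation becomes uniform. -/
theorem tendsto_softAlloc_atTop {L : ℕ} (hL : 1 ≤ L) (φavg : ℝ) (s : Fin L → ℝ) (i : Fin L) :
    Tendsto (fun ε => softAlloc L φavg s ε i) atTop (𝓝 φavg) := by
  have hL' : (L : ℝ) ≠ 0 := by positivity
  have hexp (j : Fin L) : Tendsto (fun ε : ℝ => Real.exp (-s j / ε)) atTop (𝓝 1) := by
    have h : Tendsto (fun ε : ℝ => -s j / ε) atTop (𝓝 0) :=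
      tendsto_const_nhds.div_atTop tendsto_id
    simpa [Function.comp_def] using (Real.continuous_exp.tendsto 0).comp h
  have hsum : Tendsto (fun ε : ℝ => ∑ j, Real.exp (-s j / ε)) atTop (𝓝 (L : ℝ)) := by
    simpa using tendsto_finsetSum Finset.univ fun j _ => hexp j
  have h := ((hexp i).const_mul ((L : ℝ) * φavg)).div hsum hL'
  rwa [mul_one, mul_div_cancel_left₀ _ hL'] at h

theorem sum_exp_pos {L : ℕ} (hL : 1 ≤ L) (f : Fin L → ℝ) : 0 < ∑ j, Real.exp (f j) := by
  have : Nonempty (Fin L) := ⟨⟨0, hL⟩⟩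
  exact Finset.sum_pos (fun j _ => Real.exp_pos _) Finset.univ_nonempty

theorem softAlloc_pos {L : ℕ} (hL : 1 ≤ L) {φavg : ℝ} (h0 : 0 < φavg) (s : Fin L → ℝ) (ε : ℝ)
    (i : Fin L) : 0 < softAlloc L φavg s ε i := by
  have := sum_exp_pos hL fun j => -s j / ε
  unfold softAlloc
  positivity

theorem sum_softAlloc {L : ℕ} (hL : 1 ≤ L) (φavg : ℝ) (s : Fin L → ℝ) (ε : ℝ) :
    ∑ i, softAlloc L φavg s ε i = L * φavg := by
  have := sum_exp_pos hL fun j => -s j / ε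
  simp only [softAlloc]
  rw [← Finset.sum_div, ← Finset.mul_sum, mul_div_cancel_right₀ _ this.ne']

theorem log_softAlloc {L : ℕ} (hL : 1 ≤ L) {φavg : ℝ} (h0 : 0 < φavg) (s : Fin L → ℝ) (ε : ℝ)
    (i : Fin L) : Real.log (softAlloc L φavg s ε i) =
      Real.log (L * φavg) - Real.log (∑ j, Real.exp (-s j / ε)) - s i / ε := by
  have := sum_exp_pos hL fun j => -s j / ε
  have hL' : (L : ℝ) ≠ 0 := by positivity
  rw [softAlloc, Real.log_div (by positivity) this.ne', Real.log_mul (by positivity)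
    (Real.exp_pos _).ne', Real.log_exp]
  ring

/-- The tangent line inequality for the concave function `q ↦ -q log q` at `p`. -/
theorem neg_mul_log_le_tangent {p q : ℝ} (hp : 0 < p) (hq : 0 ≤ q) :
    -(q * Real.log q) ≤ -(q * Real.log p) + (p - q) := by
  rcases hq.eq_or_lt with rfl | hq
  · simpa using hp.le
  · have h := mul_le_mul_of_nonneg_left (Real.log_le_sub_one_of_pos (div_pos hp hq)) hq.le
    rw [Real.log_div hp.ne' hq.ne', mul_sub, mul_sub, mul_div_cancel₀ _ hq.ne'] at h
    linarith

/-- Among nonnegative vectors with the same total, the softmax allocation maximizes the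
objective. -/
theorem sparsityObj_le_softAlloc {L : ℕ} (hL : 1 ≤ L) (s : Fin L → ℝ) {φavg ε : ℝ}
    (h0 : 0 < φavg) (hε : 0 < ε) {ψ : Fin L → ℝ} (hsum : ∑ i, ψ i = L * φavg)
    (hψ : ∀ i, 0 ≤ ψ i) :
    sparsityObj L s ε ψ ≤ sparsityObj L s ε (softAlloc L φavg s ε) := by
  set C := Real.log (L * φavg) - Real.log (∑ j, Real.exp (-s j / ε)) with hC
  have key (i : Fin L) : s i * (1 - ψ i) + ε * (-(ψ i * Real.log (ψ i))) ≤
      s i * (1 - softAlloc L φavg s ε i) +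
        ε * (-(softAlloc L φavg s ε i * Real.log (softAlloc L φavg s ε i))) +
        ε * (C + 1) * (softAlloc L φavg s ε i - ψ i) := by
    have h := mul_le_mul_of_nonneg_left
      (neg_mul_log_le_tangent (softAlloc_pos hL h0 s ε i) (hψ i)) hε.le
    have hlog : ε * Real.log (softAlloc L φavg s ε i) = ε * C - s i := by
      rw [log_softAlloc hL h0, ← hC, mul_sub, mul_div_cancel₀ _ hε.ne']
    linear_combination h + (softAlloc L φavg s ε i - ψ i) * hlog
  have hzero : ∑ i, ε * (C + 1) * (softAlloc L φavg s ε i - ψ i) = 0 := by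
    rw [← Finset.mul_sum, Finset.sum_sub_distrib, sum_softAlloc hL, hsum, sub_self, mul_zero]
  refine (Finset.sum_le_sum fun i _ => key i).trans_eq ?_
  rw [Finset.sum_add_distrib, hzero, add_zero, sparsityObj]

/-- **Global sparsity allocation** (Theorem 4): for sufficiently large temperature `ε`,
the softmax allocation is feasible and maximizes the entropic-regularized objective over
the constraint set `{φ : (1/L)∑φᵢ = φ_avg, 0 ≤ φᵢ ≤ 1}`. -/
theorem global_sparsity_allocation
    {L : ℕ} (hL : 1 ≤ L) (s : Fin L → ℝ) (φavg : ℝ) (h0 : 0 < φavg) (h1 : φavg < 1) :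
    ∃ ε₀ > 0, ∀ ε > ε₀,
      (((∑ i, softAlloc L φavg s ε i) / (L : ℝ) = φavg) ∧
        (∀ i, 0 ≤ softAlloc L φavg s ε i ∧ softAlloc L φavg s ε i ≤ 1)) ∧
      ∀ ψ : Fin L → ℝ,
        (((∑ i, ψ i) / (L : ℝ) = φavg) ∧ (∀ i, 0 ≤ ψ i ∧ ψ i ≤ 1)) →
        sparsityObj L s ε ψ ≤ sparsityObj L s ε (softAlloc L φavg s ε) := by
  have hL' : (L : ℝ) ≠ 0 := by positivity
  obtain ⟨a, ha⟩ := Filter.eventually_atTop.1 <| Filter.eventually_all.2 fun i =>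
    (tendsto_softAlloc_atTop hL φavg s i).eventually_le_const h1
  refine ⟨max a 1, by positivity, fun ε hε => ⟨⟨?_, fun i => ⟨(softAlloc_pos hL h0 s ε i).le,
    ha ε ((le_max_left a 1).trans hε.le) i⟩⟩, fun ψ hψ => ?_⟩⟩
  · rw [sum_softAlloc hL, mul_div_cancel_left₀ _ hL']
  · refine sparsityObj_le_softAlloc hL s h0
      (zero_lt_one.trans ((le_max_right a 1).trans_lt hε)) ?_ fun i => (hψ.2 i).1
    rw [← hψ.1, mul_div_cancel₀ _ hL']

end
end
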